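/- arXiv:2512.02421 — 2 statements merged into one kernel-verified Lean document; each statement's English description precedes it below -/
import Mathlib

section
/- Let d ≥ 1, δ ∈ (0,1), C ≥ 0, c_L ≥ 0, d̃ ≥ 0, d_0 > 0 be real numbers, let n be a real number with n ≥ 1, and for i = 1,…,d let π_i > 0 with π_i·n ≥ 1, π'_i ≥ 0, and d_i > 0. Set N = 2n, c_π = Σ_{i=1}^d π'_i/√π_i, and c(δ) = min_{1≤i≤d} √((log(2n) + (1/d_0)·log(1/δ)) / (log(π_i·n) + (1/d_i)·log(3/δ))). Define Upp_agg(δ') = c_π·√(c_L·log(1/δ')/(2n)) + C·√((d̃·log n + log(1/δ'))/n) + C·Σ_{i=1}^d π'_i·√((d_i·log(π_i·n) + log(1/δ'))/(π_i·n)), Upp_cls(δ') = C·√((d_0·log N + log(1/δ'))/N), and ε = c_π·√(c_L·log(3/δ)/N) + C·√((2·d̃·log(N/2) + 2·log(3/δ))/N). If Σ_{i=1}^d π'_i·√(2·d_i)/√π_i ≤ c(δ)·√d_0, then Upp_agg(δ/3) ≤ Upp_cls(δ) + ε. -/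
open Finset

/-- Corollary 2 of the paper: under the VC-dimension condition, the upper bound
`Upp_agg(δ/3)` for the aggregated predictor is at most `Upp_cls(δ) + ε`. -/
theorem stmt_1
    (d : ℕ) (hd : 0 < d)
    (δ : ℝ) (hδ : δ ∈ Set.Ioo (0 : ℝ) 1)
    (C : ℝ) (hC : 0 ≤ C)
    (cL : ℝ) (hcL : 0 ≤ cL)
    (dtil : ℝ) (hdtil : 0 ≤ dtil)
    (d0 : ℝ) (hd0 : 0 < d0)
    (n : ℝ) (hn : 1 ≤ n)
    (π π' di : Fin d → ℝ)
    (hπ : ∀ i, 0 < π i) (hπn : ∀ i, 1 ≤ π i * n)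
    (hπ' : ∀ i, 0 ≤ π' i) (hdi : ∀ i, 0 < di i)
    -- N = 2n, c_π, c(δ)
    (N : ℝ) (hN : N = 2 * n)
    (cπ : ℝ) (hcπ : cπ = ∑ i, π' i / Real.sqrt (π i))
    (cδ : ℝ)
    (hcδ : cδ = Finset.univ.inf' (Finset.univ_nonempty_iff.mpr ⟨⟨0, hd⟩⟩)
      (fun i => Real.sqrt ((Real.log (2 * n) + (1 / d0) * Real.log (1 / δ)) /
        (Real.log (π i * n) + (1 / di i) * Real.log (3 / δ)))))
    -- the condition of Corollary 2
    (hcond : ∑ i, π' i * Real.sqrt (2 * di i) / Real.sqrt (π i) ≤ cδ * Real.sqrt d0)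
    -- Upp_agg(δ'), Upp_cls(δ'), ε
    (UppAgg UppCls : ℝ → ℝ)
    (hUppAgg : ∀ δ', UppAgg δ' =
      cπ * Real.sqrt (cL * Real.log (1 / δ') / (2 * n))
      + C * Real.sqrt ((dtil * Real.log n + Real.log (1 / δ')) / n)
      + C * ∑ i, π' i *
          Real.sqrt ((di i * Real.log (π i * n) + Real.log (1 / δ')) / (π i * n)))
    (hUppCls : ∀ δ', UppCls δ' =
      C * Real.sqrt ((d0 * Real.log N + Real.log (1 / δ')) / N))
    (ε : ℝ)
    (hε : ε = cπ * Real.sqrt (cL * Real.log (3 / δ) / N)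
      + C * Real.sqrt ((2 * dtil * Real.log (N / 2) + 2 * Real.log (3 / δ)) / N)) :
    UppAgg (δ / 3) ≤ UppCls δ + ε := by
  obtain ⟨hδ0, hδ1⟩ := hδ
  have hn0 : 0 < n := by linarith
  have hlog1 : 0 < Real.log (1 / δ) := Real.log_pos ((one_lt_div hδ0).2 hδ1)
  have hlog3 : 0 < Real.log (3 / δ) := Real.log_pos ((one_lt_div hδ0).2 (by linarith))
  have hlog2n : 0 < Real.log (2 * n) := Real.log_pos (by linarith)
  have hdiv : 1 / (δ / 3) = 3 / δ := by field_simp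
  set A : ℝ := Real.log (2 * n) + (1 / d0) * Real.log (1 / δ) with hA
  set B : Fin d → ℝ := fun i => Real.log (π i * n) + (1 / di i) * Real.log (3 / δ) with hB
  have hA0 : 0 < A := by positivity
  have hB0 : ∀ i, 0 < B i := fun i =>
    add_pos_of_nonneg_of_pos (Real.log_nonneg (hπn i))
      (mul_pos (one_div_pos.2 (hdi i)) hlog3)
  have hcδ0 : 0 < cδ := by
    rw [hcδ, Finset.lt_inf'_iff]
    exact fun i _ => Real.sqrt_pos.2 (div_pos hA0 (hB0 i))
  have hcδB : ∀ i, cδ * Real.sqrt (B i) ≤ Real.sqrt A := fun i => by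
    have hle : cδ ≤ Real.sqrt (A / B i) := by
      rw [hcδ]
      exact Finset.inf'_le _ (Finset.mem_univ i)
    rwa [Real.sqrt_div hA0.le, le_div_iff₀ (Real.sqrt_pos.2 (hB0 i))] at hle
  have hterm : ∀ i, π' i *
      Real.sqrt ((di i * Real.log (π i * n) + Real.log (3 / δ)) / (π i * n)) =
      π' i * Real.sqrt (2 * di i) / Real.sqrt (π i) * Real.sqrt (B i) / Real.sqrt (2 * n) := by
    intro i
    have hd := hdi i
    have hp := hπ i
    have harg : (di i * Real.log (π i * n) + Real.log (3 / δ)) / (π i * n) =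
        2 * di i / π i * B i / (2 * n) := by
      simp only [hB]
      field_simp
    rw [harg, Real.sqrt_div' _ (by positivity), Real.sqrt_mul' _ (hB0 i).le,
      Real.sqrt_div' _ hp.le]
    ring
  have hcls : Real.sqrt ((d0 * Real.log N + Real.log (1 / δ)) / N) =
      Real.sqrt d0 * Real.sqrt A / Real.sqrt (2 * n) := by
    have harg : d0 * Real.log N + Real.log (1 / δ) = d0 * A := by
      rw [hN, hA]
      field_simp
    rw [harg, hN, Real.sqrt_div' _ (by positivity), Real.sqrt_mul' _ hA0.le]
  have hweighted : ∑ i, π' i * Real.sqrt (2 * di i) / Real.sqrt (π i) * Real.sqrt (B i) ≤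
      Real.sqrt d0 * Real.sqrt A := by
    refine le_of_mul_le_mul_left ?_ hcδ0
    calc cδ * ∑ i, π' i * Real.sqrt (2 * di i) / Real.sqrt (π i) * Real.sqrt (B i)
        = ∑ i, π' i * Real.sqrt (2 * di i) / Real.sqrt (π i) * (cδ * Real.sqrt (B i)) := by
          rw [Finset.mul_sum]
          exact Finset.sum_congr rfl fun i _ => by ring
      _ ≤ ∑ i, π' i * Real.sqrt (2 * di i) / Real.sqrt (π i) * Real.sqrt A :=
          Finset.sum_le_sum fun i _ => mul_le_mul_of_nonneg_left (hcδB i)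
            (div_nonneg (mul_nonneg (hπ' i) (Real.sqrt_nonneg _)) (Real.sqrt_nonneg _))
      _ = (∑ i, π' i * Real.sqrt (2 * di i) / Real.sqrt (π i)) * Real.sqrt A := by
          rw [Finset.sum_mul]
      _ ≤ cδ * Real.sqrt d0 * Real.sqrt A :=
          mul_le_mul_of_nonneg_right hcond (Real.sqrt_nonneg _)
      _ = cδ * (Real.sqrt d0 * Real.sqrt A) := by ring
  have hexperts : ∑ i, π' i *
      Real.sqrt ((di i * Real.log (π i * n) + Real.log (3 / δ)) / (π i * n)) ≤
      Real.sqrt ((d0 * Real.log N + Real.log (1 / δ)) / N) := by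
    rw [Finset.sum_congr rfl fun i _ => hterm i, ← Finset.sum_div, hcls]
    exact div_le_div_of_nonneg_right hweighted (Real.sqrt_nonneg _)
  have hagg : (2 * dtil * Real.log (N / 2) + 2 * Real.log (3 / δ)) / N =
      (dtil * Real.log n + Real.log (3 / δ)) / n := by
    rw [hN, mul_div_cancel_left₀ n two_ne_zero]
    field_simp
  rw [hUppAgg, hUppCls, hε, hdiv, hagg, ← hN]
  linarith [mul_le_mul_of_nonneg_left hexperts hC]
end

section
/- Let d ≥ 1, δ ∈ (0,1), d_0 > 0 be real numbers, let n be a real number with n ≥ 1, and for i = 1,…,d let π_i > 0 with π_i·n ≥ 1, π'_i ≥ 0, and d_i > 0. Set c(δ) = min_{1≤i≤d} √((log(2n) + (1/d_0)·log(1/δ)) / (log(π_i·n) + (1/d_i)·log(3/δ))). If Σ_{i=1}^d π'_i·√(2·d_i)/√π_i ≤ c(δ)·√d_0, then Σ_{i=1}^d π'_i·√((d_i·log(π_i·n) + log(3/δ))/(π_i·n)) ≤ √((d_0·log(2n) + log(1/δ))/(2n)). -/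
open Finset

/-- The key inequality chain in the proof of Corollary 2: under the condition on
the VC-dimension parameters, the weighted sum of per-domain generalization terms
is bounded by the generalization term of the universal predictor. -/
theorem stmt_2
    (d : ℕ) (hd : 0 < d)
    (δ : ℝ) (hδ : δ ∈ Set.Ioo (0 : ℝ) 1)
    (d0 : ℝ) (hd0 : 0 < d0)
    (n : ℝ) (hn : 1 ≤ n)
    (π π' di : Fin d → ℝ)
    (hπ : ∀ i, 0 < π i) (hπn : ∀ i, 1 ≤ π i * n)
    (hπ' : ∀ i, 0 ≤ π' i) (hdi : ∀ i, 0 < di i)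
    (cδ : ℝ)
    (hcδ : cδ = Finset.univ.inf' (Finset.univ_nonempty_iff.mpr ⟨⟨0, hd⟩⟩)
      (fun i => Real.sqrt ((Real.log (2 * n) + (1 / d0) * Real.log (1 / δ)) /
        (Real.log (π i * n) + (1 / di i) * Real.log (3 / δ)))))
    (hcond : ∑ i, π' i * Real.sqrt (2 * di i) / Real.sqrt (π i) ≤ cδ * Real.sqrt d0) :
    ∑ i, π' i * Real.sqrt ((di i * Real.log (π i * n) + Real.log (3 / δ)) / (π i * n)) ≤
      Real.sqrt ((d0 * Real.log (2 * n) + Real.log (1 / δ)) / (2 * n)) := by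
  obtain ⟨hδ0, hδ1⟩ := hδ
  have hn0 : 0 < n := by linarith
  set A := Real.log (2 * n) + (1 / d0) * Real.log (1 / δ) with hA
  set B : Fin d → ℝ := fun i => Real.log (π i * n) + (1 / di i) * Real.log (3 / δ) with hB
  have hA_pos : 0 < A := by
    have h1 : 0 < Real.log (2 * n) := Real.log_pos (by linarith)
    have h2 : 0 < Real.log (1 / δ) := Real.log_pos (by rw [lt_div_iff₀ hδ0]; linarith)
    positivity
  have hB_pos : ∀ i, 0 < B i := fun i => by
    have h1 : 0 ≤ Real.log (π i * n) := Real.log_nonneg (hπn i)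
    have h2 : 0 < Real.log (3 / δ) := Real.log_pos (by rw [lt_div_iff₀ hδ0]; linarith)
    have h3 := hdi i
    simp only [hB]
    positivity
  have hc_pos : 0 < cδ := by
    rw [hcδ, Finset.lt_inf'_iff]
    exact fun i _ => Real.sqrt_pos.mpr (div_pos hA_pos (hB_pos i))
  have hc_le : ∀ i, √(B i) ≤ √A / cδ := fun i => by
    have h : cδ ≤ √(A / B i) := hcδ ▸ Finset.inf'_le _ (Finset.mem_univ i)
    rw [Real.sqrt_div hA_pos.le, le_div_iff₀ (Real.sqrt_pos.mpr (hB_pos i))] at h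
    rw [le_div_iff₀ hc_pos]
    linarith
  have hterm : ∀ i, √((di i * Real.log (π i * n) + Real.log (3 / δ)) / (π i * n)) =
      √(2 * di i) / √(π i) * (√(B i) / √(2 * n)) := fun i => by
    have h1 := hdi i
    have h2 := hπ i
    rw [← Real.sqrt_div (by positivity), ← Real.sqrt_div (hB_pos i).le,
      ← Real.sqrt_mul (by positivity)]
    congr 1
    simp only [hB]
    field_simp
  have hrhs : √((d0 * Real.log (2 * n) + Real.log (1 / δ)) / (2 * n)) =
      √d0 * √A / √(2 * n) := by
    rw [← Real.sqrt_mul hd0.le, ← Real.sqrt_div (by positivity), hA]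
    congr 1
    field_simp
  rw [hrhs]
  calc ∑ i, π' i * √((di i * Real.log (π i * n) + Real.log (3 / δ)) / (π i * n))
      ≤ ∑ i, π' i * √(2 * di i) / √(π i) * (√A / cδ / √(2 * n)) := by
        refine Finset.sum_le_sum fun i _ => ?_
        rw [hterm, ← mul_assoc, ← mul_div_assoc (π' i)]
        have h1 := hπ' i
        have h2 := hc_le i
        gcongr
    _ = (∑ i, π' i * √(2 * di i) / √(π i)) * (√A / cδ / √(2 * n)) := by
        rw [Finset.sum_mul]
    _ ≤ cδ * √d0 * (√A / cδ / √(2 * n)) := by gcongr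
    _ = √d0 * √A / √(2 * n) := by field_simp
end
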